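/- arXiv:1211.4469 — 2 statements merged into one kernel-verified Lean document; each statement's English description precedes it below -/
import Mathlib

section
/- Let (Ω,F,P) be a standard atomless probability space and Z = B(Ω,F) the Banach space of bounded random variables (uniform limits of simple functions) with the supremum norm. Suppose a total preorder ⪯ on Z is law invariant, continuous in the supremum norm, monotonic (Z ≥ V pointwise implies Z ⪰ V), and satisfies the dual independence axiom for random variables. Then there exists a nondecreasing function w : [0,1] → [0,1] such that the Choquet functional U(Z) = −∫_{−∞}^0 w(F_Z(η)) dη + ∫_0^∞ [1 − w(F_Z(η))] dη is a numerical representation of ⪯. -/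
open MeasureTheory

/-- Two real random variables are comonotonic. -/
def Comonotone {Ω : Type*} (Z V : Ω → ℝ) : Prop :=
  ∀ ω ω', 0 ≤ (Z ω - Z ω') * (V ω - V ω')

/-- Strict preference associated with a weak preference relation `pref x y` (= "x ⪰ y"). -/
def StrictPref {X : Type*} (pref : X → X → Prop) (x y : X) : Prop :=
  pref x y ∧ ¬ pref y x

/-- The prospect space `B(Ω,F)` of bounded measurable random variables (the uniform
limits of simple functions). -/
def BoundedRV {Ω : Type*} [MeasurableSpace Ω] : Set (Ω → ℝ) :=
  {Z | Measurable Z ∧ ∃ C : ℝ, ∀ ω, |Z ω| ≤ C}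

/-- Uniform (supremum norm) convergence of random variables. -/
def UnifTendstoRV {Ω : Type*} (Vs : ℕ → Ω → ℝ) (V : Ω → ℝ) : Prop :=
  ∀ ε > (0:ℝ), ∃ N, ∀ n ≥ N, ∀ ω, |Vs n ω - V ω| ≤ ε

/-- The distribution function `F_Z(η) = P(Z ≤ η)`. -/
noncomputable def distRV {Ω : Type*} [MeasurableSpace Ω] (P : Measure Ω)
    (Z : Ω → ℝ) (η : ℝ) : ℝ :=
  (P {ω | Z ω ≤ η}).toReal

/-- The Choquet functional
`U(Z) = −∫_{−∞}^0 w(F_Z(η)) dη + ∫_0^∞ [1 − w(F_Z(η))] dη`. -/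
noncomputable def choquetRV {Ω : Type*} [MeasurableSpace Ω] (P : Measure Ω)
    (w : ℝ → ℝ) (Z : Ω → ℝ) : ℝ :=
  -(∫ η in Set.Iic (0:ℝ), w (distRV P Z η)) +
    ∫ η in Set.Ici (0:ℝ), (1 - w (distRV P Z η))

section BoundedRV

variable {Ω : Type*} [MeasurableSpace Ω]

lemma const_mem_boundedRV (c : ℝ) : (fun _ : Ω => c) ∈ BoundedRV :=
  ⟨measurable_const, |c|, fun _ => le_rfl⟩

lemma add_mem_boundedRV {Z V : Ω → ℝ} (hZ : Z ∈ BoundedRV) (hV : V ∈ BoundedRV) :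
    (fun ω => Z ω + V ω) ∈ BoundedRV := by
  obtain ⟨hZm, C, hC⟩ := hZ
  obtain ⟨hVm, D, hD⟩ := hV
  exact ⟨hZm.add hVm, C + D, fun ω => (abs_add_le _ _).trans (add_le_add (hC ω) (hD ω))⟩

lemma const_mul_mem_boundedRV (a : ℝ) {Z : Ω → ℝ} (hZ : Z ∈ BoundedRV) :
    (fun ω => a * Z ω) ∈ BoundedRV := by
  obtain ⟨hZm, C, hC⟩ := hZ
  refine ⟨hZm.const_mul a, |a| * C, fun ω => ?_⟩
  rw [abs_mul]
  exact mul_le_mul_of_nonneg_left (hC ω) (abs_nonneg a)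

lemma mix_mem_boundedRV (a : ℝ) {Z V : Ω → ℝ} (hZ : Z ∈ BoundedRV) (hV : V ∈ BoundedRV) :
    (fun ω => a * Z ω + (1 - a) * V ω) ∈ BoundedRV :=
  add_mem_boundedRV (const_mul_mem_boundedRV a hZ) (const_mul_mem_boundedRV (1 - a) hV)

lemma Monotone.comp_mem_boundedRV {f : ℝ → ℝ} (hf : Monotone f) {Z : Ω → ℝ}
    (hZ : Z ∈ BoundedRV) : (fun ω => f (Z ω)) ∈ BoundedRV := by
  obtain ⟨hZm, C, hC⟩ := hZ
  refine ⟨hf.measurable.comp hZm, max |f (-C)| |f C|, fun ω => ?_⟩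
  have h := abs_le.mp (hC ω)
  exact abs_le_max_abs_abs (hf h.1) (hf h.2)

lemma indicator_one_mem_boundedRV {A : Set Ω} (hA : MeasurableSet A) :
    A.indicator (fun _ => (1 : ℝ)) ∈ BoundedRV := by
  refine ⟨measurable_const.indicator hA, 1, fun ω => ?_⟩
  by_cases h : ω ∈ A <;> simp [h]

end BoundedRV

lemma Comonotone.const_left {Ω : Type*} (c : ℝ) (Z : Ω → ℝ) : Comonotone (fun _ => c) Z := by
  intro ω ω'; simp

lemma Comonotone.const_right {Ω : Type*} (c : ℝ) (Z : Ω → ℝ) : Comonotone Z (fun _ => c) := by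
  intro ω ω'; simp

lemma Comonotone.of_monotone_comp {Ω : Type*} {f g : ℝ → ℝ} (hf : Monotone f) (hg : Monotone g)
    (Z : Ω → ℝ) : Comonotone (fun ω => f (Z ω)) (fun ω => g (Z ω)) := by
  intro ω ω'
  rcases le_total (Z ω) (Z ω') with h | h
  · exact mul_nonneg_of_nonpos_of_nonpos (sub_nonpos.2 (hf h)) (sub_nonpos.2 (hg h))
  · exact mul_nonneg (sub_nonneg.2 (hf h)) (sub_nonneg.2 (hg h))

lemma unifTendstoRV_of_tendsto_const_mul {Ω : Type*} {c : ℕ → ℝ} {a : ℝ}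
    (hc : Filter.Tendsto c Filter.atTop (nhds a)) {α : ℝ} (hα : α ∈ Set.Icc (0 : ℝ) 1)
    (Z : Ω → ℝ) :
    UnifTendstoRV (fun n ω => α * c n + Z ω) (fun ω => α * a + Z ω) := by
  intro ε hε
  obtain ⟨N, hN⟩ := Metric.tendsto_atTop.1 hc ε hε
  refine ⟨N, fun n hn ω => ?_⟩
  have h₁ := (hN n hn).le
  rw [Real.dist_eq] at h₁
  rw [add_sub_add_right_eq_sub, ← mul_sub, abs_mul, abs_of_nonneg hα.1]
  exact (mul_le_of_le_one_left (abs_nonneg _) hα.2).trans h₁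

/-- A weak preference relation on bounded random variables satisfying the axioms of the dual
utility theory. -/
structure IsDualPref {Ω : Type*} [MeasurableSpace Ω] (P : Measure Ω)
    (pref : (Ω → ℝ) → (Ω → ℝ) → Prop) : Prop where
  refl : ∀ Z ∈ BoundedRV, pref Z Z
  trans : ∀ Z V W : Ω → ℝ, Z ∈ BoundedRV → V ∈ BoundedRV → W ∈ BoundedRV →
    pref Z V → pref V W → pref Z W
  total : ∀ Z V : Ω → ℝ, Z ∈ BoundedRV → V ∈ BoundedRV → pref Z V ∨ pref V Z
  law : ∀ Z V : Ω → ℝ, Z ∈ BoundedRV → V ∈ BoundedRV →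
    Measure.map Z P = Measure.map V P → pref Z V ∧ pref V Z
  mono : ∀ Z V : Ω → ℝ, Z ∈ BoundedRV → V ∈ BoundedRV → (∀ ω, V ω ≤ Z ω) → pref Z V
  cont : ∀ Z ∈ BoundedRV, ∀ (Vs : ℕ → Ω → ℝ) (V : Ω → ℝ),
    (∀ n, Vs n ∈ BoundedRV) → V ∈ BoundedRV → UnifTendstoRV Vs V →
    ((∀ n, pref Z (Vs n)) → pref Z V) ∧ ((∀ n, pref (Vs n) Z) → pref V Z)
  indep : ∀ Z V W : Ω → ℝ, Z ∈ BoundedRV → V ∈ BoundedRV → W ∈ BoundedRV →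
    Comonotone Z V → Comonotone Z W → Comonotone V W → StrictPref pref Z V →
    ∀ α ∈ Set.Ioo (0 : ℝ) 1,
      StrictPref pref (fun ω => α * Z ω + (1 - α) * W ω) (fun ω => α * V ω + (1 - α) * W ω)

/-- A normalized, monotone, law invariant, positively homogeneous and comonotonically additive
functional on bounded random variables. -/
structure IsComonotoneFunctional {Ω : Type*} [MeasurableSpace Ω] (P : Measure Ω)
    (U : (Ω → ℝ) → ℝ) : Prop where
  map_const : ∀ c : ℝ, U (fun _ => c) = c
  mono : ∀ Z V : Ω → ℝ, Z ∈ BoundedRV → V ∈ BoundedRV → (∀ ω, V ω ≤ Z ω) → U V ≤ U Z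
  law : ∀ Z V : Ω → ℝ, Z ∈ BoundedRV → V ∈ BoundedRV →
    Measure.map Z P = Measure.map V P → U Z = U V
  map_mul : ∀ a : ℝ, 0 ≤ a → ∀ Z : Ω → ℝ, Z ∈ BoundedRV → U (fun ω => a * Z ω) = a * U Z
  map_add : ∀ Z V : Ω → ℝ, Z ∈ BoundedRV → V ∈ BoundedRV → Comonotone Z V →
    U (fun ω => Z ω + V ω) = U Z + U V

namespace IsDualPref

variable {Ω : Type*} [MeasurableSpace Ω] {P : Measure Ω} {pref : (Ω → ℝ) → (Ω → ℝ) → Prop}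

lemma strictPref_const (h : IsDualPref P pref) {Z V : Ω → ℝ} (hZ : Z ∈ BoundedRV)
    (hV : V ∈ BoundedRV) (hZV : StrictPref pref Z V) {a b : ℝ} (hab : b < a) :
    StrictPref pref (fun _ => a) (fun _ => b) := by
  obtain ⟨C, hC⟩ := hZ.2
  obtain ⟨D, hD⟩ := hV.2
  set M : ℝ := max C D + |a - b| + 1 with hM
  have hdiff : 0 < a - b := sub_pos.2 hab
  have habs : |a - b| = a - b := abs_of_pos hdiff
  have hCM : ∀ ω, Z ω ≤ max C D := fun ω => ((abs_le.mp (hC ω)).2).trans (le_max_left _ _)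
  have hDM : ∀ ω, -max C D ≤ V ω := fun ω =>
    (neg_le_neg (le_max_right C D)).trans (abs_le.mp (hD ω)).1
  have hne : Nonempty Ω := by
    by_contra hne
    rw [not_nonempty_iff] at hne
    exact hZV.2 (by rw [Subsingleton.elim V Z]; exact h.refl Z hZ)
  have hmax : 0 ≤ max C D :=
    (abs_nonneg _).trans ((hC hne.some).trans (le_max_left _ _))
  have hMpos : 0 < M := by rw [hM, habs]; linarith
  have hMM : StrictPref pref (fun _ => M) (fun _ => -M) := by
    have h₁ : pref (fun _ => M) Z := h.mono _ _ (const_mem_boundedRV M) hZ fun ω => by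
      have := hCM ω; rw [hM, habs]; linarith
    have h₂ : pref V (fun _ => -M) := h.mono _ _ hV (const_mem_boundedRV (-M)) fun ω => by
      have := hDM ω; rw [hM, habs]; linarith
    refine ⟨h.trans _ _ _ (const_mem_boundedRV _) hV (const_mem_boundedRV _)
      (h.trans _ _ _ (const_mem_boundedRV _) hZ hV h₁ hZV.1) h₂, fun hc => hZV.2 ?_⟩
    exact h.trans _ _ _ hV (const_mem_boundedRV _) hZ h₂
      (h.trans _ _ _ (const_mem_boundedRV _) (const_mem_boundedRV _) hZ hc h₁)
  set α : ℝ := (a - b) / (2 * M) with hα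
  have hα₀ : 0 < α := by positivity
  have hα₁ : α < 1 := by
    rw [hα, div_lt_one (by positivity), hM, habs]; linarith
  have hαM : α * M = (a - b) / 2 := by rw [hα]; field_simp
  have hα₁' : 1 - α ≠ 0 := (sub_pos.2 hα₁).ne'
  have key := h.indep _ _ (fun _ => (a + b) / 2 / (1 - α)) (const_mem_boundedRV M)
    (const_mem_boundedRV (-M)) (const_mem_boundedRV _) (.const_left _ _) (.const_left _ _)
    (.const_left _ _) hMM α ⟨hα₀, hα₁⟩
  have e₁ : α * M + (1 - α) * ((a + b) / 2 / (1 - α)) = a := by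
    rw [mul_div_cancel₀ _ hα₁', hαM]; ring
  have e₂ : α * -M + (1 - α) * ((a + b) / 2 / (1 - α)) = b := by
    rw [mul_div_cancel₀ _ hα₁', mul_neg, hαM]; ring
  simpa only [e₁, e₂] using key

lemma exists_certaintyEquivalent (h : IsDualPref P pref) {Z : Ω → ℝ} (hZ : Z ∈ BoundedRV) :
    ∃ c : ℝ, pref Z (fun _ => c) ∧ pref (fun _ => c) Z := by
  have hunif : ∀ {c : ℕ → ℝ} {a : ℝ}, Filter.Tendsto c Filter.atTop (nhds a) →
      UnifTendstoRV (fun n (_ : Ω) => c n) (fun _ => a) := fun hc => by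
    simpa using unifTendstoRV_of_tendsto_const_mul hc (α := 1) (by simp) (fun _ : Ω => 0)
  have hclosed₁ : IsClosed {c : ℝ | pref Z (fun _ => c)} := IsSeqClosed.isClosed
    fun c a hmem hc => (h.cont Z hZ _ _ (fun n => const_mem_boundedRV (c n))
      (const_mem_boundedRV a) (hunif hc)).1 hmem
  have hclosed₂ : IsClosed {c : ℝ | pref (fun _ => c) Z} := IsSeqClosed.isClosed
    fun c a hmem hc => (h.cont Z hZ _ _ (fun n => const_mem_boundedRV (c n))
      (const_mem_boundedRV a) (hunif hc)).2 hmem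
  obtain ⟨C, hC⟩ := hZ.2
  obtain ⟨c, -, hc⟩ := isPreconnected_closed_iff.1 isPreconnected_univ _ _ hclosed₁ hclosed₂
    (fun c _ => h.total _ _ hZ (const_mem_boundedRV c))
    ⟨-C, trivial, h.mono _ _ hZ (const_mem_boundedRV _) fun ω => (abs_le.mp (hC ω)).1⟩
    ⟨C, trivial, h.mono _ _ (const_mem_boundedRV _) hZ fun ω => (abs_le.mp (hC ω)).2⟩
  exact ⟨c, hc⟩

lemma mix_const_equiv (h : IsDualPref P pref)
    (hconst : ∀ a b : ℝ, b < a → StrictPref pref (fun _ => a) (fun _ => b))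
    {Z W : Ω → ℝ} (hZ : Z ∈ BoundedRV) (hW : W ∈ BoundedRV) (hZW : Comonotone Z W) {c : ℝ}
    (h₁ : pref Z (fun _ => c)) (h₂ : pref (fun _ => c) Z) {α : ℝ} (hα : α ∈ Set.Ioo (0 : ℝ) 1) :
    pref (fun ω => α * Z ω + (1 - α) * W ω) (fun ω => α * c + (1 - α) * W ω) ∧
      pref (fun ω => α * c + (1 - α) * W ω) (fun ω => α * Z ω + (1 - α) * W ω) := by
  have hu : Filter.Tendsto (fun n : ℕ => 1 / ((n : ℝ) + 1)) Filter.atTop (nhds 0) :=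
    tendsto_one_div_add_atTop_nhds_zero_nat
  have hα' : α ∈ Set.Icc (0 : ℝ) 1 := ⟨hα.1.le, hα.2.le⟩
  have hmem : ∀ d : ℝ, (fun ω => α * d + (1 - α) * W ω) ∈ BoundedRV := fun d =>
    mix_mem_boundedRV α (const_mem_boundedRV d) hW
  constructor
  · refine (h.cont _ (mix_mem_boundedRV α hZ hW)
      (fun n ω => α * (c - 1 / ((n : ℝ) + 1)) + (1 - α) * W ω) _ (fun n => hmem _) (hmem c)
      (unifTendstoRV_of_tendsto_const_mul (by simpa using hu.const_sub c) hα' _)).1 fun n => ?_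
    have hlt := hconst c (c - 1 / ((n : ℝ) + 1)) (sub_lt_self _ (by positivity))
    refine (h.indep Z (fun _ => c - 1 / ((n : ℝ) + 1)) W hZ (const_mem_boundedRV _) hW
      (.const_right _ _) hZW (.const_left _ _) ⟨?_, fun hc => hlt.2 ?_⟩ α hα).1
    · exact h.trans _ _ _ hZ (const_mem_boundedRV _) (const_mem_boundedRV _) h₁ hlt.1
    · exact h.trans _ _ _ (const_mem_boundedRV _) hZ (const_mem_boundedRV _) hc h₁
  · refine (h.cont _ (mix_mem_boundedRV α hZ hW)
      (fun n ω => α * (c + 1 / ((n : ℝ) + 1)) + (1 - α) * W ω) _ (fun n => hmem _) (hmem c)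
      (unifTendstoRV_of_tendsto_const_mul (by simpa using hu.const_add c) hα' _)).2 fun n => ?_
    have hlt := hconst (c + 1 / ((n : ℝ) + 1)) c (lt_add_of_pos_right _ (by positivity))
    refine (h.indep (fun _ => c + 1 / ((n : ℝ) + 1)) Z W (const_mem_boundedRV _) hZ hW
      (.const_left _ _) (.const_left _ _) hZW ⟨?_, fun hc => hlt.2 ?_⟩ α hα).1
    · exact h.trans _ _ _ (const_mem_boundedRV _) (const_mem_boundedRV _) hZ hlt.1 h₂
    · exact h.trans _ _ _ (const_mem_boundedRV _) hZ (const_mem_boundedRV _) h₂ hc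

/-- A nontrivial dual preference is represented by its certainty equivalent, which is a
comonotonically additive functional. -/
lemma exists_isComonotoneFunctional (h : IsDualPref P pref) {Z₀ V₀ : Ω → ℝ}
    (hZ₀ : Z₀ ∈ BoundedRV) (hV₀ : V₀ ∈ BoundedRV) (hlt : StrictPref pref Z₀ V₀) :
    ∃ U : (Ω → ℝ) → ℝ, IsComonotoneFunctional P U ∧
      ∀ Z V : Ω → ℝ, Z ∈ BoundedRV → V ∈ BoundedRV → (StrictPref pref Z V ↔ U V < U Z) := by
  have hconst : ∀ a b : ℝ, b < a → StrictPref pref (fun _ : Ω => a) (fun _ => b) :=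
    fun a b => h.strictPref_const hZ₀ hV₀ hlt
  choose! U hU₁ hU₂ using fun Z (hZ : Z ∈ BoundedRV) => h.exists_certaintyEquivalent hZ
  have hle : ∀ a b : ℝ, pref (fun _ : Ω => a) (fun _ => b) ↔ b ≤ a := fun a b =>
    ⟨fun hab => not_lt.1 fun hlt => (hconst b a hlt).2 hab,
      fun hab => h.mono _ _ (const_mem_boundedRV _) (const_mem_boundedRV _) fun _ => hab⟩
  have hrep : ∀ Z V : Ω → ℝ, Z ∈ BoundedRV → V ∈ BoundedRV → (pref Z V ↔ U V ≤ U Z) := by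
    intro Z V hZ hV
    rw [← hle]
    have cZ := const_mem_boundedRV (Ω := Ω) (U Z)
    have cV := const_mem_boundedRV (Ω := Ω) (U V)
    exact ⟨fun hp => h.trans _ _ _ cZ hV cV (h.trans _ _ _ cZ hZ hV (hU₂ Z hZ) hp) (hU₁ V hV),
      fun hp => h.trans _ _ _ hZ cV hV (h.trans _ _ _ hZ cZ cV (hU₁ Z hZ) hp) (hU₂ V hV)⟩
  have heq : ∀ Z V : Ω → ℝ, Z ∈ BoundedRV → V ∈ BoundedRV → pref Z V → pref V Z → U Z = U V :=
    fun Z V hZ hV h₁ h₂ => le_antisymm ((hrep V Z hV hZ).1 h₂) ((hrep Z V hZ hV).1 h₁)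
  have hUc : ∀ c : ℝ, U (fun _ => c) = c := fun c =>
    le_antisymm ((hle _ _).1 (hU₁ _ (const_mem_boundedRV c)))
      ((hle _ _).1 (hU₂ _ (const_mem_boundedRV c)))
  have hmix : ∀ Z W : Ω → ℝ, Z ∈ BoundedRV → W ∈ BoundedRV → Comonotone Z W →
      ∀ α ∈ Set.Ioo (0 : ℝ) 1,
        U (fun ω => α * Z ω + (1 - α) * W ω) = α * U Z + (1 - α) * U W := by
    intro Z W hZ hW hZW α hα
    have cZ := const_mem_boundedRV (Ω := Ω) (U Z)
    have h₁ := h.mix_const_equiv hconst hZ hW hZW (hU₁ Z hZ) (hU₂ Z hZ) hα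
    have hα' : 1 - α ∈ Set.Ioo (0 : ℝ) 1 := ⟨by linarith [hα.2], by linarith [hα.1]⟩
    have h₂ := h.mix_const_equiv hconst hW cZ (.const_right _ _) (hU₁ W hW) (hU₂ W hW) hα'
    simp only [sub_sub_cancel] at h₂
    simp only [add_comm ((1 - α) * _) (α * _)] at h₂
    rw [heq _ _ (mix_mem_boundedRV α hZ hW) (mix_mem_boundedRV α cZ hW) h₁.1 h₁.2,
      heq _ _ (mix_mem_boundedRV α cZ hW) (const_mem_boundedRV _) h₂.1 h₂.2, hUc]
  have hsmul : ∀ a ∈ Set.Ioo (0 : ℝ) 1, ∀ Z : Ω → ℝ, Z ∈ BoundedRV →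
      U (fun ω => a * Z ω) = a * U Z := by
    intro a ha Z hZ
    simpa [hUc] using hmix Z (fun _ => 0) hZ (const_mem_boundedRV 0) (.const_right _ _) a ha
  refine ⟨U, ⟨hUc, fun Z V hZ hV hVZ => (hrep Z V hZ hV).1 (h.mono Z V hZ hV hVZ),
    fun Z V hZ hV hlaw => heq Z V hZ hV (h.law Z V hZ hV hlaw).1 (h.law Z V hZ hV hlaw).2,
    ?_, ?_⟩, fun Z V hZ hV => ?_⟩
  · intro a ha Z hZ
    rcases ha.eq_or_lt with rfl | ha₀
    · simpa using hUc 0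
    rcases lt_trichotomy a 1 with ha₁ | rfl | ha₁
    · exact hsmul a ⟨ha₀, ha₁⟩ Z hZ
    · simp
    · have := hsmul a⁻¹ ⟨inv_pos.2 ha₀, inv_lt_one_of_one_lt₀ ha₁⟩ _
        (const_mul_mem_boundedRV a hZ)
      simp only [inv_mul_cancel_left₀ ha₀.ne'] at this
      rw [this, mul_inv_cancel_left₀ ha₀.ne']
  · intro Z V hZ hV hZV
    have h₁ := hmix Z V hZ hV hZV (1 / 2) (by norm_num)
    have h₂ := hsmul (1 / 2) (by norm_num) _ (add_mem_boundedRV hZ hV)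
    have e : (fun ω => 1 / 2 * Z ω + (1 - 1 / 2) * V ω) = fun ω => 1 / 2 * (Z ω + V ω) := by
      funext ω; ring
    rw [e, h₂] at h₁
    linarith
  · rw [StrictPref, hrep Z V hZ hV, hrep V Z hV hZ, not_le]
    exact ⟨fun h => h.2, fun h => ⟨h.le, h⟩⟩

end IsDualPref

/-- Increments squeezed between the lower and upper Riemann sums of an antitone function are
unique. -/
lemma sub_eq_sub_of_antitone_bounds {g φ ψ : ℝ → ℝ}
    (hφ : ∀ x y, x ≤ y → φ y - φ x ∈ Set.Icc ((y - x) * g y) ((y - x) * g x))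
    (hψ : ∀ x y, x ≤ y → ψ y - ψ x ∈ Set.Icc ((y - x) * g y) ((y - x) * g x))
    {a b : ℝ} (hab : a ≤ b) : φ b - φ a = ψ b - ψ a := by
  have hstep : ∀ x y, x ≤ y →
      |(φ y - ψ y) - (φ x - ψ x)| ≤ (y - x) * (g x - g y) := by
    intro x y hxy
    obtain ⟨h₁, h₂⟩ := hφ x y hxy
    obtain ⟨h₃, h₄⟩ := hψ x y hxy
    rw [abs_le]
    constructor <;> linarith
  have hbound : ∀ n : ℕ,
      |(φ b - ψ b) - (φ a - ψ a)| ≤ ((b - a) * (g a - g b)) * (1 / ((n : ℝ) + 1)) := by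
    intro n
    have hn : (0 : ℝ) < (n : ℝ) + 1 := by positivity
    set d : ℝ := (b - a) / ((n : ℝ) + 1) with hd
    have hd₀ : 0 ≤ d := div_nonneg (sub_nonneg.2 hab) hn.le
    set x : ℕ → ℝ := fun k => a + k * d with hx
    have hx₀ : x 0 = a := by simp [hx]
    have hxn : x (n + 1) = b := by simp only [hx, hd]; push_cast; field_simp; ring
    have hsucc : ∀ k, x (k + 1) - x k = d := fun k => by simp only [hx]; push_cast; ring
    have e₁ := Finset.sum_range_sub (fun k => φ (x k) - ψ (x k)) (n + 1)
    have e₂ := Finset.sum_range_sub (fun k => g (x k)) (n + 1)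
    simp only [hx₀, hxn] at e₁ e₂
    rw [← e₁]
    refine (Finset.abs_sum_le_sum_abs _ _).trans ?_
    calc _ ≤ ∑ k ∈ Finset.range (n + 1), -d * (g (x (k + 1)) - g (x k)) := by
          refine Finset.sum_le_sum fun k _ => ?_
          have := hstep (x k) (x (k + 1)) (by linarith [hsucc k])
          rw [hsucc] at this
          linarith
      _ = _ := by rw [← Finset.mul_sum, e₂, hd]; field_simp; ring
  have hlim := (tendsto_one_div_add_atTop_nhds_zero_nat (𝕜 := ℝ)).const_mul
    ((b - a) * (g a - g b))
  rw [mul_zero] at hlim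
  have := abs_nonpos_iff.1 (ge_of_tendsto' hlim hbound)
  linarith

lemma Antitone.integral_mem_Icc {g : ℝ → ℝ} (hg : Antitone g) {a b : ℝ} (hab : a ≤ b) :
    ∫ t in a..b, g t ∈ Set.Icc ((b - a) * g b) ((b - a) * g a) := by
  have hi : IntervalIntegrable g volume a b := hg.intervalIntegrable
  constructor
  · have := intervalIntegral.integral_mono_on hab intervalIntegrable_const hi
      fun t ht => hg ht.2
    simpa using this
  · have := intervalIntegral.integral_mono_on hab hi intervalIntegrable_const
      fun t ht => hg ht.1
    simpa using this

lemma choquetRV_zero {Ω : Type*} [MeasurableSpace Ω] (P : Measure Ω) (Z : Ω → ℝ) :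
    choquetRV P (fun _ => 0) Z = 0 := by
  simp [choquetRV, integral_const, measureReal_def]

lemma distRV_eq_zero {Ω : Type*} [MeasurableSpace Ω] {P : Measure Ω} {Z : Ω → ℝ} {η : ℝ}
    (h : ∀ ω, η < Z ω) : distRV P Z η = 0 := by
  simp [distRV, fun ω => not_le.2 (h ω)]

section distRV

variable {Ω : Type*} [MeasurableSpace Ω] {P : Measure Ω} [IsProbabilityMeasure P]

lemma distRV_mono (Z : Ω → ℝ) : Monotone (distRV P Z) := fun _ _ h =>
  ENNReal.toReal_mono (measure_ne_top _ _) (measure_mono fun _ hω => le_trans hω h)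

lemma distRV_mem_Icc (Z : Ω → ℝ) (η : ℝ) : distRV P Z η ∈ Set.Icc (0 : ℝ) 1 :=
  ⟨ENNReal.toReal_nonneg, measureReal_le_one⟩

lemma distRV_eq_one {Z : Ω → ℝ} {η : ℝ} (h : ∀ ω, Z ω ≤ η) : distRV P Z η = 1 := by
  simp [distRV, h]

/-- For a normalized distortion and a random variable bounded by `C`, the Choquet functional is an
integral over `[-C, C]`. -/
lemma choquetRV_eq_integral {w : ℝ → ℝ} (hw : MonotoneOn w (Set.Icc 0 1)) (hw₀ : w 0 = 0)
    (hw₁ : w 1 = 1) {Z : Ω → ℝ} {C : ℝ} (hC₀ : 0 ≤ C) (hC : ∀ ω, |Z ω| ≤ C) :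
    choquetRV P w Z = -C + ∫ η in (-C)..C, (1 - w (distRV P Z η)) := by
  have hmono : Monotone fun η => w (distRV P Z η) := fun a b hab =>
    hw (distRV_mem_Icc Z a) (distRV_mem_Icc Z b) (distRV_mono Z hab)
  have hwint : ∀ a b : ℝ, IntervalIntegrable (fun η => w (distRV P Z η)) volume a b :=
    fun a b => hmono.intervalIntegrable
  have hneg : ∫ η in Set.Iic (0 : ℝ), w (distRV P Z η) = ∫ η in (-C)..0, w (distRV P Z η) := by
    rw [intervalIntegral.integral_of_le (by linarith), ← integral_Icc_eq_integral_Ioc]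
    refine setIntegral_eq_of_subset_of_forall_sdiff_eq_zero measurableSet_Iic
      (fun _ h => h.2) fun η hη => ?_
    have hη' : η < -C := not_le.1 fun h => hη.2 ⟨h, hη.1⟩
    rw [distRV_eq_zero fun ω => hη'.trans_le (abs_le.mp (hC ω)).1, hw₀]
  have hpos : ∫ η in Set.Ici (0 : ℝ), (1 - w (distRV P Z η)) =
      ∫ η in (0 : ℝ)..C, (1 - w (distRV P Z η)) := by
    rw [intervalIntegral.integral_of_le hC₀, ← integral_Icc_eq_integral_Ioc]
    refine setIntegral_eq_of_subset_of_forall_sdiff_eq_zero measurableSet_Ici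
      (fun _ h => h.1) fun η hη => ?_
    have hη' : C < η := not_le.1 fun h => hη.2 ⟨hη.1, h⟩
    rw [distRV_eq_one fun ω => (abs_le.mp (hC ω)).2.trans hη'.le, hw₁, sub_self]
  have hwint' : ∀ a b : ℝ, IntervalIntegrable (fun η => 1 - w (distRV P Z η)) volume a b :=
    fun a b => intervalIntegrable_const.sub (hwint a b)
  rw [choquetRV, hneg, hpos,
    ← intervalIntegral.integral_add_adjacent_intervals (hwint' (-C) 0) (hwint' 0 C),
    intervalIntegral.integral_sub intervalIntegrable_const (hwint (-C) 0)]
  simp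
  ring

end distRV

lemma map_indicator_one_eq {Ω : Type*} [MeasurableSpace Ω] {P : Measure Ω}
    [IsProbabilityMeasure P] {A B : Set Ω} (hA : MeasurableSet A) (hB : MeasurableSet B)
    (hAB : P A = P B) :
    Measure.map (A.indicator fun _ => (1 : ℝ)) P = Measure.map (B.indicator fun _ => 1) P := by
  have hc : P Aᶜ = P Bᶜ := by rw [prob_compl_eq_one_sub hA, prob_compl_eq_one_sub hB, hAB]
  classical
  ext S hS
  rw [Measure.map_apply (measurable_const.indicator hA) hS,
    Measure.map_apply (measurable_const.indicator hB) hS,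
    Set.indicator_const_preimage_eq_union, Set.indicator_const_preimage_eq_union]
  split_ifs <;> simp [hAB, hc]

/-- On an atomless space, a comonotonically additive functional is a Choquet functional. -/
lemma IsComonotoneFunctional.exists_choquetRV_eq {Ω : Type*} [MeasurableSpace Ω] {P : Measure Ω}
    [IsProbabilityMeasure P] {U : (Ω → ℝ) → ℝ} (h : IsComonotoneFunctional P U) {X : Ω → ℝ}
    (hX : Measurable X) (hXlaw : Measure.map X P = volume.restrict (Set.Icc (0 : ℝ) 1)) :
    ∃ w : ℝ → ℝ, MonotoneOn w (Set.Icc 0 1) ∧ Set.MapsTo w (Set.Icc 0 1) (Set.Icc 0 1) ∧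
      ∀ Z ∈ BoundedRV, choquetRV P w Z = U Z := by
  have hmeas : ∀ {Z : Ω → ℝ}, Measurable Z → ∀ t, MeasurableSet {ω | t < Z ω} :=
    fun hZ t => measurableSet_lt measurable_const hZ
  set w : ℝ → ℝ := fun p => 1 - U ({ω | p < X ω}.indicator fun _ => 1) with hw
  have hanti : ∀ {Z : Ω → ℝ}, Measurable Z →
      Antitone fun t => U ({ω | t < Z ω}.indicator fun _ => 1) := fun hZ s t hst =>
    h.mono _ _ (indicator_one_mem_boundedRV (hmeas hZ s))
      (indicator_one_mem_boundedRV (hmeas hZ t)) fun ω =>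
      Set.indicator_le_indicator_of_subset (fun _ hω => lt_of_le_of_lt hst hω)
        (fun _ => zero_le_one) ω
  have hwmono : Monotone w := fun p q hpq => sub_le_sub_left (hanti hX hpq) 1
  have hPX : ∀ p ∈ Set.Icc (0 : ℝ) 1, P {ω | p < X ω} = ENNReal.ofReal (1 - p) := by
    intro p hp
    have : Measure.map X P (Set.Ioi p) = P {ω | p < X ω} := Measure.map_apply hX measurableSet_Ioi
    rw [← this, hXlaw, Measure.restrict_apply measurableSet_Ioi]
    have e : Set.Ioi p ∩ Set.Icc 0 1 = Set.Ioc p 1 := by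
      ext t; exact ⟨fun ht => ⟨ht.1, ht.2.2⟩, fun ht => ⟨ht.1, hp.1.trans ht.1.le, ht.2⟩⟩
    rw [e, Real.volume_Ioc]
  have hind : ∀ {Z : Ω → ℝ}, Measurable Z → ∀ t,
      U ({ω | t < Z ω}.indicator fun _ => 1) = 1 - w (distRV P Z t) := by
    intro Z hZ t
    rw [hw, sub_sub_cancel]
    refine h.law _ _ (indicator_one_mem_boundedRV (hmeas hZ t))
      (indicator_one_mem_boundedRV (hmeas hX _))
      (map_indicator_one_eq (hmeas hZ t) (hmeas hX _) ?_)
    have e : {ω | t < Z ω} = {ω | Z ω ≤ t}ᶜ := by ext; simp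
    have hle : MeasurableSet {ω | Z ω ≤ t} := measurableSet_le hZ measurable_const
    rw [hPX _ (distRV_mem_Icc Z t), e, prob_compl_eq_one_sub hle,
      distRV, ENNReal.ofReal_sub _ ENNReal.toReal_nonneg, ENNReal.ofReal_one,
      ENNReal.ofReal_toReal (measure_ne_top _ _)]
  have hw₀ : w 0 = 0 := by
    have h₁ := hind (measurable_const : Measurable fun _ : Ω => (1 : ℝ)) 0
    rw [distRV_eq_zero fun _ => zero_lt_one] at h₁
    simp [h.map_const] at h₁
    linarith
  have hw₁ : w 1 = 1 := by
    have h₁ := hind (measurable_const : Measurable fun _ : Ω => (0 : ℝ)) 0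
    rw [distRV_eq_one fun _ => le_rfl] at h₁
    simp [h.map_const] at h₁
    linarith
  refine ⟨w, hwmono.monotoneOn _, fun p hp => ⟨?_, ?_⟩, fun Z hZ => ?_⟩
  · rw [← hw₀]; exact hwmono hp.1
  · rw [← hw₁]; exact hwmono hp.2
  have hZm : Measurable Z := hZ.1
  obtain ⟨C', hC'⟩ := hZ.2
  obtain ⟨C, hC₀, hC⟩ : ∃ C : ℝ, 0 ≤ C ∧ ∀ ω, |Z ω| ≤ C :=
    ⟨|C'|, abs_nonneg _, fun ω => (hC' ω).trans (le_abs_self _)⟩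
  rw [choquetRV_eq_integral (hwmono.monotoneOn _) hw₀ hw₁ hC₀ hC]
  simp only [← hind hZm]
  set g : ℝ → ℝ := fun t => U ({ω | t < Z ω}.indicator fun _ => 1) with hg
  have hmin : ∀ t : ℝ, Monotone fun x : ℝ => min x t := fun t =>
    monotone_id.min monotone_const
  have hφ : ∀ x y : ℝ, x ≤ y → U (fun ω => min (Z ω) y) - U (fun ω => min (Z ω) x) ∈
      Set.Icc ((y - x) * g y) ((y - x) * g x) := by
    intro x y hxy
    have hyx : 0 ≤ y - x := sub_nonneg.2 hxy
    have hlayer : Monotone fun z : ℝ => min (max (z - x) 0) (y - x) := fun a b hab => by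
      dsimp only; gcongr
    have hadd := h.map_add _ _ ((hmin x).comp_mem_boundedRV hZ) (hlayer.comp_mem_boundedRV hZ)
      (.of_monotone_comp (hmin x) hlayer Z)
    have e : (fun ω => min (Z ω) x + min (max (Z ω - x) 0) (y - x)) = fun ω => min (Z ω) y := by
      funext ω
      grind
    rw [e] at hadd
    have hI : ∀ t, {ω | t < Z ω}.indicator (fun _ => (1 : ℝ)) ∈ BoundedRV := fun t =>
      indicator_one_mem_boundedRV (hmeas hZm t)
    rw [hadd, add_sub_cancel_left, hg, ← h.map_mul _ hyx _ (hI y), ← h.map_mul _ hyx _ (hI x)]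
    constructor
    · refine h.mono _ _ (hlayer.comp_mem_boundedRV hZ) (const_mul_mem_boundedRV _ (hI y))
        fun ω => ?_
      simp only [Set.indicator_apply, Set.mem_ofPred_eq]
      split_ifs <;> grind
    · refine h.mono _ _ (const_mul_mem_boundedRV _ (hI x)) (hlayer.comp_mem_boundedRV hZ)
        fun ω => ?_
      simp only [Set.indicator_apply, Set.mem_ofPred_eq]
      split_ifs <;> grind
  have hganti : Antitone g := hanti hZm
  have hψ : ∀ x y : ℝ, x ≤ y → (∫ t in (0 : ℝ)..y, g t) - ∫ t in (0 : ℝ)..x, g t ∈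
      Set.Icc ((y - x) * g y) ((y - x) * g x) := fun x y hxy => by
    rw [intervalIntegral.integral_interval_sub_left hganti.intervalIntegrable
      hganti.intervalIntegrable]
    exact hganti.integral_mem_Icc hxy
  have key := sub_eq_sub_of_antitone_bounds (φ := fun t => U (fun ω => min (Z ω) t))
    (ψ := fun t => ∫ s in (0 : ℝ)..t, g s) hφ hψ (neg_le_self hC₀)
  rw [intervalIntegral.integral_interval_sub_left hganti.intervalIntegrable
    hganti.intervalIntegrable] at key
  have e₁ : (fun ω => min (Z ω) C) = Z := funext fun ω => min_eq_left (abs_le.mp (hC ω)).2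
  have e₂ : (fun ω => min (Z ω) (-C)) = fun _ => -C :=
    funext fun ω => min_eq_right (abs_le.mp (hC ω)).1
  simp only [e₁, e₂, h.map_const] at key
  rw [← key]
  ring

/-- Choquet integral representation of dual utility for bounded random variables: on a
standard atomless probability space, a law invariant, sup-norm continuous, monotonic
total preorder on `B(Ω,F)` satisfying the dual independence axiom is represented by the
Choquet functional with a nondecreasing distortion `w : [0,1] → [0,1]`. -/
theorem exists_choquet_representation_boundedRV
    {Ω : Type*} [MeasurableSpace Ω] (P : Measure Ω) [IsProbabilityMeasure P]
    (hstd : ∀ μ : Measure ℝ, IsProbabilityMeasure μ →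
      ∃ Z : Ω → ℝ, Measurable Z ∧ Measure.map Z P = μ)
    (pref : (Ω → ℝ) → (Ω → ℝ) → Prop)
    (hrefl : ∀ Z ∈ BoundedRV, pref Z Z)
    (htrans : ∀ Z V W : Ω → ℝ, Z ∈ BoundedRV → V ∈ BoundedRV → W ∈ BoundedRV →
      pref Z V → pref V W → pref Z W)
    (htotal : ∀ Z V : Ω → ℝ, Z ∈ BoundedRV → V ∈ BoundedRV → pref Z V ∨ pref V Z)
    (hlaw : ∀ Z V : Ω → ℝ, Z ∈ BoundedRV → V ∈ BoundedRV →
      Measure.map Z P = Measure.map V P → pref Z V ∧ pref V Z)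
    (hmono : ∀ Z V : Ω → ℝ, Z ∈ BoundedRV → V ∈ BoundedRV →
      (∀ ω, V ω ≤ Z ω) → pref Z V)
    (hcont : ∀ Z ∈ BoundedRV, ∀ (Vs : ℕ → Ω → ℝ) (V : Ω → ℝ),
      (∀ n, Vs n ∈ BoundedRV) → V ∈ BoundedRV → UnifTendstoRV Vs V →
      ((∀ n, pref Z (Vs n)) → pref Z V) ∧ ((∀ n, pref (Vs n) Z) → pref V Z))
    (hind : ∀ Z V W : Ω → ℝ, Z ∈ BoundedRV → V ∈ BoundedRV → W ∈ BoundedRV →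
      Comonotone Z V → Comonotone Z W → Comonotone V W → StrictPref pref Z V →
      ∀ α ∈ Set.Ioo (0:ℝ) 1,
        StrictPref pref (fun ω => α * Z ω + (1 - α) * W ω)
          (fun ω => α * V ω + (1 - α) * W ω)) :
    ∃ w : ℝ → ℝ, MonotoneOn w (Set.Icc 0 1) ∧
      Set.MapsTo w (Set.Icc 0 1) (Set.Icc 0 1) ∧
      (∀ Z V : Ω → ℝ, Z ∈ BoundedRV → V ∈ BoundedRV →
        (StrictPref pref Z V ↔ choquetRV P w Z > choquetRV P w V)) := by
  have h : IsDualPref P pref := ⟨hrefl, htrans, htotal, hlaw, hmono, hcont, hind⟩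
  by_cases hne : ∃ Z V : Ω → ℝ, Z ∈ BoundedRV ∧ V ∈ BoundedRV ∧ StrictPref pref Z V
  · obtain ⟨Z₀, V₀, hZ₀, hV₀, hlt⟩ := hne
    obtain ⟨U, hU, hrep⟩ := h.exists_isComonotoneFunctional hZ₀ hV₀ hlt
    obtain ⟨X, hX, hXlaw⟩ := hstd (volume.restrict (Set.Icc (0 : ℝ) 1)) ⟨by simp⟩
    obtain ⟨w, hw, hw', hwU⟩ := hU.exists_choquetRV_eq hX hXlaw
    refine ⟨w, hw, hw', fun Z V hZ hV => ?_⟩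
    rw [hwU Z hZ, hwU V hV]
    exact hrep Z V hZ hV
  · -- If all prospects are indifferent, the zero distortion works, because the divergent
    -- integral of the constant `1` over `[0, ∞)` is zero by convention.
    push Not at hne
    refine ⟨fun _ => 0, monotoneOn_const, fun _ _ => by simp, fun Z V hZ hV => ?_⟩
    simp [choquetRV_zero, hne Z V hZ hV]
end

section
/- Let S be a Polish space and M(S) the space of finite signed regular Borel measures on S, equipped with the topology of weak convergence (μ_n → μ iff ∫ f dμ_n → ∫ f dμ for every bounded continuous f : S → ℝ). A functional U : M(S) → ℝ is linear and sequentially continuous with respect to weak convergence if and only if there exists a bounded continuous function f : S → ℝ such that U(μ) = ∫_S f(z) dμ(z) for all μ ∈ M(S). -/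
open MeasureTheory Filter

/-- The integral of a function with respect to a finite signed measure, via the Jordan
decomposition. -/
noncomputable def signedIntegral {S : Type*} [MeasurableSpace S]
    (μ : SignedMeasure S) (f : S → ℝ) : ℝ :=
  ∫ z, f z ∂μ.toJordanDecomposition.posPart - ∫ z, f z ∂μ.toJordanDecomposition.negPart

/-- Weak convergence of a sequence of finite signed measures: convergence of the
integrals of all bounded continuous functions. -/
def WeakTendsto {S : Type*} [MeasurableSpace S] [TopologicalSpace S]
    (μs : ℕ → SignedMeasure S) (μ : SignedMeasure S) : Prop :=
  ∀ f : S → ℝ, Continuous f → (∃ C : ℝ, ∀ z, |f z| ≤ C) →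
    Tendsto (fun n => signedIntegral (μs n) f) atTop (nhds (signedIntegral μ f))

/-- A bounded continuous function is integrable against every finite
Borel measure. -/
theorem Continuous.integrable_of_abs_le {S : Type*} [MeasurableSpace S] [TopologicalSpace S]
    [BorelSpace S] {f : S → ℝ} (hf : Continuous f) (hb : ∃ C : ℝ, ∀ z, |f z| ≤ C)
    (P : Measure S) [IsFiniteMeasure P] : Integrable f P := by
  obtain ⟨C, hC⟩ := hb
  exact .of_bound hf.measurable.aestronglyMeasurable C (.of_forall hC)

/-- The signed integral may be computed from any decomposition into a difference of finite
measures. -/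
theorem signedIntegral_toSignedMeasure_sub {S : Type*} [MeasurableSpace S] (P N : Measure S)
    [IsFiniteMeasure P] [IsFiniteMeasure N] {f : S → ℝ}
    (hf : ∀ (Q : Measure S) [IsFiniteMeasure Q], Integrable f Q) :
    signedIntegral (P.toSignedMeasure - N.toSignedMeasure) f = ∫ z, f z ∂P - ∫ z, f z ∂N := by
  set j := (P.toSignedMeasure - N.toSignedMeasure).toJordanDecomposition with hj
  have h : j.posPart.toSignedMeasure - j.negPart.toSignedMeasure =
      P.toSignedMeasure - N.toSignedMeasure :=
    SignedMeasure.toSignedMeasure_toJordanDecomposition _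
  have h' : j.posPart + N = P + j.negPart := by
    rw [← Measure.toSignedMeasure_eq_toSignedMeasure_iff, Measure.toSignedMeasure_add,
      Measure.toSignedMeasure_add]
    exact sub_eq_sub_iff_add_eq_add.mp h
  have h'' := congrArg (fun Q => ∫ z, f z ∂Q) h'
  simp only [integral_add_measure (hf _) (hf _)] at h''
  rw [signedIntegral, ← hj]
  linarith

theorem signedIntegral_toSignedMeasure {S : Type*} [MeasurableSpace S] (P : Measure S)
    [IsFiniteMeasure P] {f : S → ℝ}
    (hf : ∀ (Q : Measure S) [IsFiniteMeasure Q], Integrable f Q) :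
    signedIntegral P.toSignedMeasure f = ∫ z, f z ∂P := by
  simpa using signedIntegral_toSignedMeasure_sub P 0 hf

theorem signedIntegral_add {S : Type*} [MeasurableSpace S] (μ ν : SignedMeasure S) {f : S → ℝ}
    (hf : ∀ (Q : Measure S) [IsFiniteMeasure Q], Integrable f Q) :
    signedIntegral (μ + ν) f = signedIntegral μ f + signedIntegral ν f := by
  have h : μ + ν = (μ.toJordanDecomposition.posPart +
      ν.toJordanDecomposition.posPart).toSignedMeasure -
      (μ.toJordanDecomposition.negPart + ν.toJordanDecomposition.negPart).toSignedMeasure := by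
    conv_lhs => rw [← μ.toSignedMeasure_toJordanDecomposition,
      ← ν.toSignedMeasure_toJordanDecomposition]
    rw [Measure.toSignedMeasure_add, Measure.toSignedMeasure_add]
    simp only [JordanDecomposition.toSignedMeasure]
    abel
  rw [h, signedIntegral_toSignedMeasure_sub _ _ hf, integral_add_measure (hf _) (hf _),
    integral_add_measure (hf _) (hf _), signedIntegral, signedIntegral]
  ring

theorem signedIntegral_smul {S : Type*} [MeasurableSpace S] (a : ℝ) (μ : SignedMeasure S)
    (f : S → ℝ) : signedIntegral (a • μ) f = a * signedIntegral μ f := by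
  simp only [signedIntegral, SignedMeasure.toJordanDecomposition_smul_real]
  rcases le_or_gt 0 a with ha | ha
  · rw [JordanDecomposition.real_smul_posPart_nonneg _ _ ha,
      JordanDecomposition.real_smul_negPart_nonneg _ _ ha, integral_smul_nnreal_measure,
      integral_smul_nnreal_measure]
    simp only [NNReal.smul_def, Real.coe_toNNReal _ ha, smul_eq_mul]
    ring
  · rw [JordanDecomposition.real_smul_posPart_neg _ _ ha,
      JordanDecomposition.real_smul_negPart_neg _ _ ha, integral_smul_nnreal_measure,
      integral_smul_nnreal_measure]
    simp only [NNReal.smul_def, Real.coe_toNNReal _ (neg_nonneg.mpr ha.le), smul_eq_mul]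
    ring

theorem MeasureTheory.SimpleFunc.integral_comp_eq_sum {S T : Type*} [MeasurableSpace S]
    (φ : SimpleFunc S T) (P : Measure S) [IsFiniteMeasure P] (g : T → ℝ) :
    ∫ x, g (φ x) ∂P = ∑ y ∈ φ.range, P.real (φ ⁻¹' {y}) * g y := by
  classical
  have h : ∀ x, g (φ x) = ∑ y ∈ φ.range, (φ ⁻¹' {y}).indicator (fun _ => g y) x := by
    intro x
    rw [Finset.sum_eq_single_of_mem (φ x) (φ.mem_range_self x)]
    · simp
    · intro y _ hy
      have hx : x ∉ φ ⁻¹' {y} := fun hx => hy (Set.mem_singleton_iff.mp hx).symm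
      exact Set.indicator_of_notMem hx (fun _ => g y)
  simp_rw [h]
  rw [integral_finsetSum _ fun y _ =>
    (integrable_const (g y)).indicator (φ.measurableSet_fiber y)]
  exact Finset.sum_congr rfl fun y _ => by
    rw [integral_indicator_const _ (φ.measurableSet_fiber y), smul_eq_mul]

theorem MeasureTheory.SimpleFunc.toSignedMeasure_map {S T : Type*} [MeasurableSpace S]
    [MeasurableSpace T] (φ : SimpleFunc S T) (hφ : Measurable φ) (P : Measure S)
    [IsFiniteMeasure P] :
    (P.map φ).toSignedMeasure =
      ∑ y ∈ φ.range, P.real (φ ⁻¹' {y}) • (Measure.dirac y).toSignedMeasure := by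
  ext s hs
  have h := φ.integral_comp_eq_sum P (s.indicator fun _ => 1)
  have h' : (fun x => s.indicator (fun _ => (1 : ℝ)) (φ x)) =
      (φ ⁻¹' s).indicator fun _ => 1 := rfl
  rw [h', integral_indicator_const _ (hφ hs), smul_eq_mul, mul_one] at h
  rw [Measure.toSignedMeasure_apply_measurable hs, map_measureReal_apply hφ hs, h, _root_.sum_apply]
  refine Finset.sum_congr rfl fun y _ => ?_
  rw [_root_.smul_apply, Measure.toSignedMeasure_apply_measurable hs, smul_eq_mul]
  by_cases hy : y ∈ s <;> simp [Measure.real, Measure.dirac_apply' _ hs, hy]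

/-- A weakly sequentially continuous linear functional is determined on finite measures by its
values on Dirac masses. -/
theorem eq_integral_dirac_of_weakTendsto_continuous
    {S : Type*} [MeasurableSpace S] [TopologicalSpace S] [PolishSpace S] [BorelSpace S]
    (U : SignedMeasure S →ₗ[ℝ] ℝ)
    (hU : ∀ (μs : ℕ → SignedMeasure S) (μ : SignedMeasure S), WeakTendsto μs μ →
      Tendsto (fun n => U (μs n)) atTop (nhds (U μ)))
    (hc : Continuous fun x : S => U (Measure.dirac x).toSignedMeasure)
    (hb : ∃ C : ℝ, ∀ x : S, |U (Measure.dirac x).toSignedMeasure| ≤ C)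
    (P : Measure S) [IsFiniteMeasure P] :
    U P.toSignedMeasure = ∫ x, U (Measure.dirac x).toSignedMeasure ∂P := by
  rcases isEmpty_or_nonempty S with hS | ⟨⟨x₀⟩⟩
  · obtain rfl : P = 0 := Subsingleton.elim _ _
    simp
  let := TopologicalSpace.upgradeIsCompletelyMetrizable S
  let φ : ℕ → SimpleFunc S S :=
    SimpleFunc.approxOn id measurable_id Set.univ x₀ (Set.mem_univ x₀)
  have hφ : ∀ x, Tendsto (fun n => φ n x) atTop (nhds x) := fun x =>
    SimpleFunc.tendsto_approxOn measurable_id (Set.mem_univ x₀) (by simp)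
  have hlim : ∀ g : S → ℝ, Continuous g → (∃ C : ℝ, ∀ z, |g z| ≤ C) →
      Tendsto (fun n => ∫ x, g (φ n x) ∂P) atTop (nhds (∫ x, g x ∂P)) := by
    rintro g hg ⟨C, hC⟩
    exact tendsto_integral_of_dominated_convergence (fun _ => C)
      (fun n => (hg.measurable.comp (φ n).measurable).aestronglyMeasurable)
      (integrable_const C) (fun n => .of_forall fun x => hC _)
      (.of_forall fun x => (hg.tendsto x).comp (hφ x))
  have hweak : WeakTendsto (fun n => (P.map (φ n)).toSignedMeasure) P.toSignedMeasure := by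
    intro g hg hgb
    have hint : ∀ (Q : Measure S) [IsFiniteMeasure Q], Integrable g Q :=
      fun Q _ => hg.integrable_of_abs_le hgb Q
    simp only [signedIntegral_toSignedMeasure _ hint]
    refine (hlim g hg hgb).congr fun n => ?_
    rw [integral_map (φ n).measurable.aemeasurable hg.measurable.aestronglyMeasurable]
  refine tendsto_nhds_unique (hU _ _ hweak) ((hlim _ hc hb).congr fun n => ?_)
  rw [(φ n).toSignedMeasure_map (φ n).measurable P, map_sum, (φ n).integral_comp_eq_sum P
    fun x => U (Measure.dirac x).toSignedMeasure]
  simp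

/-- Banach-type representation theorem: a functional on the space of finite signed
Borel measures on a Polish space is linear and sequentially continuous with respect to
weak convergence if and only if it is the integral of some bounded continuous function. -/
theorem linear_weakly_continuous_iff_integral_of_boundedContinuous
    {S : Type*} [MeasurableSpace S] [TopologicalSpace S] [PolishSpace S] [BorelSpace S]
    (U : SignedMeasure S → ℝ) :
    ((∀ (a b : ℝ) (μ ν : SignedMeasure S), U (a • μ + b • ν) = a * U μ + b * U ν) ∧
      (∀ (μs : ℕ → SignedMeasure S) (μ : SignedMeasure S), WeakTendsto μs μ →
        Tendsto (fun n => U (μs n)) atTop (nhds (U μ)))) ↔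
    (∃ f : S → ℝ, Continuous f ∧ (∃ C : ℝ, ∀ z, |f z| ≤ C) ∧
      ∀ μ : SignedMeasure S, U μ = signedIntegral μ f) := by
  constructor
  · rintro ⟨hlin, hU⟩
    let L : SignedMeasure S →ₗ[ℝ] ℝ :=
      { toFun := U
        map_add' := fun μ ν => by simpa using hlin 1 1 μ ν
        map_smul' := fun a μ => by simpa using hlin a 0 μ 0 }
    have hdirac : ∀ (g : S → ℝ), Continuous g → (∃ C : ℝ, ∀ z, |g z| ≤ C) → ∀ x,
        signedIntegral (Measure.dirac x).toSignedMeasure g = g x := by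
      intro g hg hgb x
      rw [signedIntegral_toSignedMeasure _ fun Q _ => hg.integrable_of_abs_le hgb Q,
        integral_dirac]
    have hc : Continuous fun x : S => U (Measure.dirac x).toSignedMeasure := by
      let := TopologicalSpace.upgradeIsCompletelyMetrizable S
      refine continuous_iff_seqContinuous.mpr fun xs x hx => hU _ _ fun g hg hgb => ?_
      simp only [hdirac g hg hgb]
      exact (hg.tendsto x).comp hx
    have hb : ∃ C : ℝ, ∀ x : S, |U (Measure.dirac x).toSignedMeasure| ≤ C := by
      by_contra! h
      choose xs hxs using fun n : ℕ => h n
      set c : ℕ → ℝ := fun n => U (Measure.dirac (xs n)).toSignedMeasure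
      have hc0 : ∀ n, c n ≠ 0 := fun n h0 => by
        have h1 : (n : ℝ) < |c n| := hxs n
        rw [h0, abs_zero] at h1
        exact (Nat.cast_nonneg n).not_gt h1
      have hc_inv : Tendsto (fun n => (c n)⁻¹) atTop (nhds 0) := by
        rw [tendsto_zero_iff_abs_tendsto_zero]
        refine (tendsto_inv_atTop_zero.comp (tendsto_atTop_mono (fun n => (hxs n).le)
          tendsto_natCast_atTop_atTop)).congr fun n => ?_
        simp [c, abs_inv]
      have hweak : WeakTendsto
          (fun n => (c n)⁻¹ • (Measure.dirac (xs n)).toSignedMeasure) 0 := by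
        intro g hg hgb
        have hzero : signedIntegral (0 : SignedMeasure S) g = 0 := by
          simpa using signedIntegral_smul 0 (0 : SignedMeasure S) g
        simp only [signedIntegral_smul, hdirac g hg hgb, hzero]
        obtain ⟨C, hC⟩ := hgb
        exact hc_inv.zero_mul_isBoundedUnder_le
          (isBoundedUnder_of ⟨C, fun n => hC (xs n)⟩)
      have hlim := hU _ _ hweak
      have hone : ∀ n, U ((c n)⁻¹ • (Measure.dirac (xs n)).toSignedMeasure) = 1 := fun n =>
        (L.map_smul _ _).trans (inv_mul_cancel₀ (hc0 n))
      simp only [hone, show U 0 = 0 from L.map_zero] at hlim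
      exact one_ne_zero (tendsto_nhds_unique tendsto_const_nhds hlim)
    refine ⟨_, hc, hb, fun μ => ?_⟩
    have hpos := fun (P : Measure S) [IsFiniteMeasure P] =>
      eq_integral_dirac_of_weakTendsto_continuous L hU hc hb P
    conv_lhs => rw [← μ.toSignedMeasure_toJordanDecomposition]
    exact (L.map_sub _ _).trans (congrArg₂ (· - ·) (hpos _) (hpos _))
  · rintro ⟨f, hf, hfb, hUf⟩
    refine ⟨fun a b μ ν => ?_, fun μs μ h => ?_⟩
    · rw [hUf, hUf, hUf, signedIntegral_add _ _ fun Q _ => hf.integrable_of_abs_le hfb Q,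
        signedIntegral_smul, signedIntegral_smul]
    · simp only [hUf]
      exact h f hf hfb
end
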